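/- arXiv:2403.04844 — 2 statements merged into one kernel-verified Lean document; each statement's English description precedes it below -/
import Mathlib

section
/- Let ρ be an n×n density matrix, let A and O be Hermitian n×n complex matrices, let U₁, U₂, Ũ₁, Ũ₂ be n×n unitary matrices, and let ε ≥ 0 satisfy ‖U₁ − Ũ₁‖ ≤ ε and ‖U₂ − Ũ₂‖ ≤ ε. Then |i·Tr[U₁·ρ·U₁†·[A, U₂†·O·U₂]] − i·Tr[Ũ₁·ρ·Ũ₁†·[A, Ũ₂†·O·Ũ₂]]| ≤ 8·ε·‖A‖·‖O‖. -/
open scoped Matrix.Norms.L2Operator ComplexOrder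
open Matrix

/-- An entry of a matrix is bounded by its `ℓ² → ℓ²` operator norm. -/
lemma Matrix.norm_entry_le_l2_opNorm {ι : Type*} [Fintype ι] [DecidableEq ι]
    (M : Matrix ι ι ℂ) (i j : ι) : ‖M i j‖ ≤ ‖M‖ := by
  have h := Matrix.l2_opNorm_mulVec M (EuclideanSpace.single j (1 : ℂ))
  rw [PiLp.norm_single, norm_one, mul_one] at h
  refine le_trans ?_ h
  have h' := PiLp.norm_apply_le
    (WithLp.toLp 2 (M *ᵥ (EuclideanSpace.single j (1 : ℂ)).ofLp) : EuclideanSpace ℂ ι) i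
  simpa using h'

/-- Hölder's inequality `|Tr(ρ X)| ≤ Tr(ρ) ‖X‖` for a positive semidefinite matrix `ρ`. -/
lemma Matrix.PosSemidef.norm_trace_mul_le {ι : Type*} [Fintype ι] [DecidableEq ι]
    {ρ : Matrix ι ι ℂ} (hρ : ρ.PosSemidef) (X : Matrix ι ι ℂ) :
    ‖(ρ * X).trace‖ ≤ ρ.trace.re * ‖X‖ := by
  set W : Matrix ι ι ℂ := (hρ.isHermitian.eigenvectorUnitary : Matrix ι ι ℂ) with hW
  have hWmem : W ∈ unitary (Matrix ι ι ℂ) := hρ.isHermitian.eigenvectorUnitary.2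
  set d := hρ.isHermitian.eigenvalues with hd
  have hspec : ρ = W * diagonal (fun i => (d i : ℂ)) * star W := by
    have h := hρ.isHermitian.spectral_theorem
    rw [Unitary.conjStarAlgAut_apply] at h
    exact h
  have htr : (ρ * X).trace = ∑ i, (d i : ℂ) * (star W * X * W) i i := by
    conv_lhs => rw [hspec]
    rw [show W * diagonal (fun i => (d i : ℂ)) * star W * X
        = W * (diagonal (fun i => (d i : ℂ)) * (star W * X)) by simp only [mul_assoc],
      Matrix.trace_mul_comm, mul_assoc]
    simp [Matrix.trace, Matrix.diagonal_mul]
  have hsum : ρ.trace.re = ∑ i, d i := by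
    rw [hρ.isHermitian.trace_eq_sum_eigenvalues]
    simp [hd]
  have hconj : ‖star W * X * W‖ = ‖X‖ := by
    rw [CStarRing.norm_mul_mem_unitary _ hWmem,
      CStarRing.norm_mem_unitary_mul _ (Unitary.star_mem hWmem)]
  rw [htr, hsum, Finset.sum_mul]
  refine (norm_sum_le _ _).trans (Finset.sum_le_sum fun i _ => ?_)
  have hdi : 0 ≤ d i := hρ.eigenvalues_nonneg i
  rw [norm_mul, Complex.norm_real, Real.norm_of_nonneg hdi, ← hconj]
  exact mul_le_mul_of_nonneg_left (Matrix.norm_entry_le_l2_opNorm _ i i) hdi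

/-- Conjugation by a unitary depends on the unitary in a Lipschitz way. -/
lemma CStarRing.norm_star_mul_mul_sub_le {E : Type*} [NormedRing E] [StarRing E] [CStarRing E]
    {U V : E} (hU : U ∈ unitary E) (hV : V ∈ unitary E) (X : E) :
    ‖star U * X * U - star V * X * V‖ ≤ 2 * ‖U - V‖ * ‖X‖ := by
  have h : star U * X * U - star V * X * V = star (U - V) * X * U + star V * (X * (U - V)) := by
    rw [star_sub]; noncomm_ring
  rw [h]
  refine (norm_add_le _ _).trans ?_
  rw [CStarRing.norm_mul_mem_unitary _ hU, CStarRing.norm_mem_unitary_mul _ (Unitary.star_mem hV)]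
  have h₁ := norm_mul_le (star (U - V)) X
  have h₂ := norm_mul_le X (U - V)
  rw [norm_star] at h₁
  linarith

lemma norm_commutator_le {E : Type*} [NormedRing E] (a b : E) :
    ‖a * b - b * a‖ ≤ 2 * ‖a‖ * ‖b‖ := by
  have h₁ := norm_mul_le a b
  have h₂ := norm_mul_le b a
  have h₃ := norm_sub_le (a * b) (b * a)
  linarith

/-- For a density matrix `ρ`, Hermitian `A, O`, unitaries `U₁, U₂, V₁, V₂`
(`V₁, V₂` playing the role of `Ũ₁, Ũ₂`) with `‖U₁ − V₁‖ ≤ ε` and `‖U₂ − V₂‖ ≤ ε`, one has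
`|i·Tr[U₁ ρ U₁† [A, U₂† O U₂]] − i·Tr[V₁ ρ V₁† [A, V₂† O V₂]]| ≤ 8 ε ‖A‖ ‖O‖`. -/
theorem stmt_4 {n : ℕ} (ρ A O U₁ U₂ V₁ V₂ : Matrix (Fin n) (Fin n) ℂ)
    (hρ : ρ.PosSemidef) (hρtr : ρ.trace = 1)
    (hA : A.IsHermitian) (hO : O.IsHermitian)
    (hU₁ : U₁ ∈ Matrix.unitaryGroup (Fin n) ℂ) (hU₂ : U₂ ∈ Matrix.unitaryGroup (Fin n) ℂ)
    (hV₁ : V₁ ∈ Matrix.unitaryGroup (Fin n) ℂ) (hV₂ : V₂ ∈ Matrix.unitaryGroup (Fin n) ℂ)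
    (ε : ℝ) (hε : 0 ≤ ε) (h₁ : ‖U₁ - V₁‖ ≤ ε) (h₂ : ‖U₂ - V₂‖ ≤ ε) :
    norm
      (Complex.I * (U₁ * ρ * U₁ᴴ * (A * (U₂ᴴ * O * U₂) - (U₂ᴴ * O * U₂) * A)).trace -
       Complex.I * (V₁ * ρ * V₁ᴴ * (A * (V₂ᴴ * O * V₂) - (V₂ᴴ * O * V₂) * A)).trace)
      ≤ 8 * ε * ‖A‖ * ‖O‖ := by
  rw [← star_eq_conjTranspose, ← star_eq_conjTranspose, ← star_eq_conjTranspose,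
    ← star_eq_conjTranspose]
  set P := star U₂ * O * U₂ with hP
  set Q := star V₂ * O * V₂ with hQ
  have hcyc (U C : Matrix (Fin n) (Fin n) ℂ) :
      (U * ρ * star U * C).trace = (ρ * (star U * C * U)).trace := by
    rw [show U * ρ * star U * C = U * (ρ * (star U * C)) by simp only [mul_assoc],
      Matrix.trace_mul_comm]
    simp only [mul_assoc]
  have hPnorm : ‖P‖ = ‖O‖ := by
    rw [hP, CStarRing.norm_mul_mem_unitary _ hU₂,
      CStarRing.norm_mem_unitary_mul _ (Unitary.star_mem hU₂)]
  have hPQ : ‖P - Q‖ ≤ 2 * ε * ‖O‖ :=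
    (CStarRing.norm_star_mul_mul_sub_le hU₂ hV₂ O).trans (by gcongr)
  have hC : ‖A * P - P * A‖ ≤ 2 * ‖A‖ * ‖O‖ := hPnorm ▸ norm_commutator_le A P
  have hU : ‖star U₁ * (A * P - P * A) * U₁ - star V₁ * (A * P - P * A) * V₁‖
      ≤ 2 * ε * (2 * ‖A‖ * ‖O‖) :=
    (CStarRing.norm_star_mul_mul_sub_le hU₁ hV₁ _).trans (by gcongr)
  have hV : ‖star V₁ * (A * (P - Q) - (P - Q) * A) * V₁‖ ≤ 2 * ‖A‖ * (2 * ε * ‖O‖) := by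
    rw [CStarRing.norm_mul_mem_unitary _ hV₁,
      CStarRing.norm_mem_unitary_mul _ (Unitary.star_mem hV₁)]
    exact (norm_commutator_le A (P - Q)).trans (by gcongr)
  have hsplit : star U₁ * (A * P - P * A) * U₁ - star V₁ * (A * Q - Q * A) * V₁
      = (star U₁ * (A * P - P * A) * U₁ - star V₁ * (A * P - P * A) * V₁)
        + star V₁ * (A * (P - Q) - (P - Q) * A) * V₁ := by
    noncomm_ring
  rw [← mul_sub, norm_mul, Complex.norm_I, one_mul, hcyc, hcyc, ← Matrix.trace_sub, ← mul_sub]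
  refine (hρ.norm_trace_mul_le _).trans ?_
  rw [hρtr, Complex.one_re, one_mul, hsplit]
  refine (norm_add_le _ _).trans ?_
  linarith
end

section
/- For N qubits and a graph E on the qubit indices, let ϑ ∈ ℝ, φ ∈ ℝ^N, define the hardware-efficient-ansatz block V = CZ_E · ∏_{j=1}^N exp(-i·φ_j·Z_j/2) · ∏_{j=1}^N exp(-i·ϑ·X_j/2), and let O = Y_1 · ∏_{j=2}^N Z_j be the global observable. Then [X_1, V† · O · V] = 2·i·cos(φ_1) · (cos(ϑ)·Z_1 + sin(ϑ)·Y_1) · ∏_{j ∈ S} (cos(ϑ)·Z_j + sin(ϑ)·Y_j), where S = {2, …, N} \ N(1) and N(1) is the set of neighbors of qubit 1 in E. -/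
open Matrix NormedSpace

namespace Qubits

noncomputable section

/-- N-qubit basis states. -/
abbrev QState (N : ℕ) := Fin N → Fin 2

/-- Operators on the N-qubit Hilbert space (dimension `2^N`). -/
abbrev QOp (N : ℕ) := Matrix (QState N) (QState N) ℂ

/-- Pauli X. -/
def pX : Matrix (Fin 2) (Fin 2) ℂ := !![0, 1; 1, 0]

/-- Pauli Y. -/
def pY : Matrix (Fin 2) (Fin 2) ℂ := !![0, -Complex.I; Complex.I, 0]

/-- Pauli Z. -/
def pZ : Matrix (Fin 2) (Fin 2) ℂ := !![1, 0; 0, -1]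

/-- The single-qubit operator `M` acting on qubit `k` and as the identity on all other qubits. -/
def onQubit {N : ℕ} (M : Matrix (Fin 2) (Fin 2) ℂ) (k : Fin N) : QOp N :=
  Matrix.of fun x y => if ∀ j, j ≠ k → x j = y j then M (x k) (y k) else 0

/-- The product `∏_{j ∈ S} f j` of matrices over a finite set of qubit indices, taken in
increasing order of the index (the factors we use always commute pairwise). -/
def prodOver {N : ℕ} (S : Finset (Fin N)) (f : Fin N → QOp N) : QOp N :=
  ((S.sort (· ≤ ·)).map f).prod

/-- The CZ layer of a graph `G` on the qubit indices: the diagonal matrix whose entry at the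
basis state `x` is `(-1)^(Σ_{{j,j'} ∈ E} x_j·x_{j'})`. -/
def czLayer {N : ℕ} (G : SimpleGraph (Fin N)) [DecidableRel G.Adj] : QOp N :=
  Matrix.diagonal fun x =>
    (-1 : ℂ) ^ ∑ e ∈ G.edgeFinset,
      Sym2.lift ⟨fun j j' => (x j : ℕ) * (x j' : ℕ), fun _ _ => Nat.mul_comm _ _⟩ e

end

end Qubits

namespace Qubits

/-- The tensor product of one single-qubit operator per qubit. -/
def tensorOp {N : ℕ} (f : Fin N → Matrix (Fin 2) (Fin 2) ℂ) : QOp N :=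
  Matrix.of fun x y => ∏ j, f j (x j) (y j)

theorem tensorOp_mul {N : ℕ} (f g : Fin N → Matrix (Fin 2) (Fin 2) ℂ) :
    tensorOp f * tensorOp g = tensorOp fun j => f j * g j := by
  ext x y
  simp only [tensorOp, Matrix.mul_apply, Matrix.of_apply, ← Finset.prod_mul_distrib]
  rw [Finset.prod_univ_sum, Fintype.piFinset_univ]

theorem tensorOp_conjTranspose {N : ℕ} (f : Fin N → Matrix (Fin 2) (Fin 2) ℂ) :
    (tensorOp f)ᴴ = tensorOp fun j => (f j)ᴴ := by
  ext x y
  simp [tensorOp, Matrix.conjTranspose_apply]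

theorem tensorOp_one {N : ℕ} :
    tensorOp (fun _ : Fin N => (1 : Matrix (Fin 2) (Fin 2) ℂ)) = 1 := by
  ext x y
  simp only [tensorOp, Matrix.of_apply, Matrix.one_apply, funext_iff]
  rw [Finset.prod_ite_zero]
  simp

theorem onQubit_eq_tensorOp {N : ℕ} (M : Matrix (Fin 2) (Fin 2) ℂ) (k : Fin N) :
    onQubit M k = tensorOp fun j => if j = k then M else 1 := by
  ext x y
  simp only [onQubit, tensorOp, Matrix.of_apply]
  rw [← Finset.mul_prod_erase _ _ (Finset.mem_univ k), if_pos rfl]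
  have h : ∏ j ∈ Finset.univ.erase k,
      (if j = k then M else (1 : Matrix (Fin 2) (Fin 2) ℂ)) (x j) (y j) =
      ∏ j ∈ Finset.univ.erase k, if x j = y j then (1 : ℂ) else 0 := by
    refine Finset.prod_congr rfl fun j hj => ?_
    rw [if_neg (Finset.ne_of_mem_erase hj), Matrix.one_apply]
  rw [h, Finset.prod_ite_zero]
  simp

theorem smul_onQubit_add_smul_onQubit {N : ℕ} (a b : ℂ) (A B : Matrix (Fin 2) (Fin 2) ℂ)
    (k : Fin N) : a • onQubit A k + b • onQubit B k = onQubit (a • A + b • B) k := by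
  ext x y
  simp only [onQubit, Matrix.add_apply, Matrix.smul_apply, Matrix.of_apply]
  split_ifs <;> simp

theorem onQubit_mul {N : ℕ} (A B : Matrix (Fin 2) (Fin 2) ℂ) (k : Fin N) :
    onQubit A k * onQubit B k = onQubit (A * B) k := by
  simp only [onQubit_eq_tensorOp, tensorOp_mul]
  congr 1
  ext1 j
  split_ifs <;> simp

theorem onQubit_one {N : ℕ} (k : Fin N) : onQubit 1 k = 1 := by
  simp only [onQubit_eq_tensorOp, ite_self, tensorOp_one]

theorem prodOver_onQubit {N : ℕ} (S : Finset (Fin N)) (M : Fin N → Matrix (Fin 2) (Fin 2) ℂ) :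
    prodOver S (fun j => onQubit (M j) j) = tensorOp fun j => if j ∈ S then M j else 1 := by
  have h : ∀ l : List (Fin N), l.Nodup →
      (l.map fun j => onQubit (M j) j).prod = tensorOp fun j => if j ∈ l then M j else 1 := by
    intro l hl
    induction l with
    | nil => simp [tensorOp_one]
    | cons a l ih =>
      obtain ⟨ha, hl⟩ := List.nodup_cons.mp hl
      rw [List.map_cons, List.prod_cons, ih hl, onQubit_eq_tensorOp, tensorOp_mul]
      congr 1
      ext1 j
      by_cases hj : j = a
      · subst hj
        simp [ha]
      · simp [hj]
  simpa [prodOver] using h _ (S.sort_nodup (· ≤ ·))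

/-- Euler's formula for an involution `A`. -/
theorem exp_smul_of_mul_self_eq_one {ι : Type*} [Fintype ι] [DecidableEq ι]
    {A : Matrix ι ι ℂ} (hA : A * A = 1) (t : ℝ) :
    exp ((-Complex.I * (t : ℂ) / 2) • A) =
      Complex.cos (t / 2) • 1 + (-Complex.I * Complex.sin (t / 2)) • A := by
  let F : ℂ × ℂ →+* Matrix ι ι ℂ :=
    { toFun := fun p => ((p.1 + p.2) / 2) • 1 + ((p.1 - p.2) / 2) • A
      map_one' := by simp
      map_zero' := by simp
      map_add' := fun p q => by
        simp only [Prod.fst_add, Prod.snd_add]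
        module
      map_mul' := fun p q => by
        simp only [Prod.fst_mul, Prod.snd_mul, add_mul, mul_add, smul_mul_assoc, mul_smul_comm,
          one_mul, mul_one, hA]
        module }
  have hF : Continuous F := by
    change Continuous fun p : ℂ × ℂ =>
      ((p.1 + p.2) / 2) • (1 : Matrix ι ι ℂ) + ((p.1 - p.2) / 2) • A
    fun_prop
  let _ : NormedRing (Matrix ι ι ℂ) := Matrix.linftyOpNormedRing
  have h := map_exp F hF (-Complex.I * (t : ℂ) / 2, Complex.I * (t : ℂ) / 2)
  have hL : F (-Complex.I * (t : ℂ) / 2, Complex.I * (t : ℂ) / 2) =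
      (-Complex.I * (t : ℂ) / 2) • A := by
    change (_ / 2 : ℂ) • (1 : Matrix ι ι ℂ) + (_ / 2 : ℂ) • A = _
    module
  rw [hL] at h
  refine h.symm.trans ?_
  change ((_ + _) / 2 : ℂ) • (1 : Matrix ι ι ℂ) + ((_ - _) / 2 : ℂ) • A = _
  rw [Prod.fst_exp, Prod.snd_exp, ← Complex.exp_eq_exp_ℂ, Complex.cos, Complex.sin,
    show -Complex.I * (t : ℂ) / 2 = -((t : ℂ) / 2) * Complex.I by ring,
    show Complex.I * (t : ℂ) / 2 = (t : ℂ) / 2 * Complex.I by ring]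
  congr 2
  · ring
  · linear_combination (Complex.exp (-((t : ℂ) / 2) * Complex.I) -
      Complex.exp ((t : ℂ) / 2 * Complex.I)) / 2 * Complex.I_mul_I

/-- The single-qubit rotation `exp(-i·t·P/2)` in closed form, for an involution `P`. -/
noncomputable def rotation (P : Matrix (Fin 2) (Fin 2) ℂ) (t : ℝ) : Matrix (Fin 2) (Fin 2) ℂ :=
  Complex.cos (t / 2) • 1 + (-Complex.I * Complex.sin (t / 2)) • P

theorem exp_smul_onQubit {N : ℕ} {P : Matrix (Fin 2) (Fin 2) ℂ} (hP : P * P = 1) (t : ℝ)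
    (k : Fin N) :
    exp ((-Complex.I * (t : ℂ) / 2) • onQubit P k) = onQubit (rotation P t) k := by
  rw [exp_smul_of_mul_self_eq_one (by rw [onQubit_mul, hP, onQubit_one]), rotation,
    ← smul_onQubit_add_smul_onQubit, onQubit_one]

theorem pX_mul_self : pX * pX = 1 := by
  ext i j; fin_cases i <;> fin_cases j <;> simp [pX]

theorem pZ_mul_self : pZ * pZ = 1 := by
  ext i j; fin_cases i <;> fin_cases j <;> simp [pZ]

theorem czLayer_conjTranspose {N : ℕ} (G : SimpleGraph (Fin N)) [DecidableRel G.Adj] :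
    (czLayer G)ᴴ = czLayer G := by
  rw [czLayer, Matrix.diagonal_conjTranspose]
  congr 1
  ext x
  simp

theorem pZ_apply_self (a : Fin 2) : pZ a a = (-1) ^ (a : ℕ) := by
  fin_cases a <;> simp [pZ]

/-- Flipping qubit `k` changes the CZ phase by the parity of the neighbours of `k`. -/
theorem czPhase_mul_czPhase {N : ℕ} (G : SimpleGraph (Fin N)) [DecidableRel G.Adj] (k : Fin N)
    (x y : QState N) (hk : x k ≠ y k) (hxy : ∀ j, j ≠ k → x j = y j) :
    (-1 : ℂ) ^ (∑ e ∈ G.edgeFinset,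
        Sym2.lift ⟨fun j j' => (x j : ℕ) * (x j' : ℕ), fun _ _ => Nat.mul_comm _ _⟩ e) *
      (-1 : ℂ) ^ (∑ e ∈ G.edgeFinset,
        Sym2.lift ⟨fun j j' => (y j : ℕ) * (y j' : ℕ), fun _ _ => Nat.mul_comm _ _⟩ e) =
      ∏ l ∈ G.neighborFinset k, (-1 : ℂ) ^ (x l : ℕ) := by
  have hsum : (x k : ℕ) + (y k : ℕ) = 1 := by omega
  rw [← Finset.prod_pow_eq_pow_sum, ← Finset.prod_pow_eq_pow_sum, ← Finset.prod_mul_distrib]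
  have hinj : Set.InjOn (fun l => s(k, l)) (G.neighborFinset k : Set (Fin N)) :=
    fun a _ b _ h => Sym2.congr_right.mp h
  have hsub : (G.neighborFinset k).image (fun l => s(k, l)) ⊆ G.edgeFinset := by
    intro e he
    obtain ⟨l, hl, rfl⟩ := Finset.mem_image.mp he
    simpa using hl
  rw [← Finset.prod_subset hsub, Finset.prod_image hinj]
  · refine Finset.prod_congr rfl fun l hl => ?_
    have hlk : l ≠ k := by
      rintro rfl
      simp at hl
    simp only [Sym2.lift_mk]
    rw [← hxy l hlk, ← pow_add, ← add_mul, hsum, one_mul]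
  · intro e he hne
    induction e with | _ a b
    have hab : G.Adj a b := by simpa using he
    have ha : a ≠ k := by
      rintro rfl
      exact hne (Finset.mem_image.mpr ⟨b, by simpa using hab, rfl⟩)
    have hb : b ≠ k := by
      rintro rfl
      exact hne (Finset.mem_image.mpr ⟨a, by simpa using hab.symm, Sym2.eq_swap⟩)
    simp only [Sym2.lift_mk]
    rw [hxy a ha, hxy b hb, ← pow_add]
    exact Even.neg_one_pow ⟨_, rfl⟩

/-- Conjugating `Y_k ∏_{j ≠ k} Z_j` by the CZ layer removes the `Z` factors at the neighbours
of `k`. -/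
theorem czLayer_conj {N : ℕ} (G : SimpleGraph (Fin N)) [DecidableRel G.Adj] (k : Fin N) :
    czLayer G * tensorOp (fun j => if j = k then pY else pZ) * czLayer G =
      tensorOp fun j => if j = k then pY else if G.Adj k j then 1 else pZ := by
  ext x y
  rw [czLayer, Matrix.mul_diagonal, Matrix.diagonal_mul]
  simp only [tensorOp, Matrix.of_apply]
  rw [← Finset.mul_prod_erase _ _ (Finset.mem_univ k),
    ← Finset.mul_prod_erase Finset.univ _ (Finset.mem_univ k), if_pos rfl, if_pos rfl]
  by_cases hk : x k = y k
  · have hY : pY (x k) (y k) = 0 := by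
      rw [hk]
      generalize y k = a
      fin_cases a <;> simp [pY]
    simp [hY]
  by_cases hxy : ∀ j, j ≠ k → x j = y j
  · rw [mul_right_comm, czPhase_mul_czPhase G k x y hk hxy, mul_left_comm]
    congr 1
    have hsub : G.neighborFinset k ⊆ Finset.univ.erase k := by
      intro l hl
      have hl' : G.Adj k l := by simpa using hl
      simpa using hl'.ne'
    rw [← Finset.prod_sdiff hsub, ← Finset.prod_sdiff hsub (f := fun j => (if j = k then pY else
      if G.Adj k j then 1 else pZ : Matrix (Fin 2) (Fin 2) ℂ) (x j) (y j)), mul_left_comm,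
      ← Finset.prod_mul_distrib]
    congr 1
    · refine Finset.prod_congr rfl fun j hj => ?_
      have hj' : j ≠ k ∧ ¬ G.Adj k j := by simpa using hj
      simp [hj'.1, hj'.2]
    · refine Finset.prod_congr rfl fun j hj => ?_
      have hj' : G.Adj k j := by simpa using hj
      rw [if_neg hj'.ne', if_neg hj'.ne', if_pos hj', ← hxy j hj'.ne', pZ_apply_self,
        Matrix.one_apply_eq, ← pow_add]
      exact Even.neg_one_pow ⟨_, rfl⟩
  · push Not at hxy
    obtain ⟨j, hj, hne⟩ := hxy
    have hmem : j ∈ Finset.univ.erase k := by simpa using hj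
    have hZ : pZ (x j) (y j) = 0 := by
      revert hne
      generalize x j = a
      generalize y j = b
      fin_cases a <;> fin_cases b <;> simp [pZ]
    rw [Finset.prod_eq_zero hmem (by simp [hj, hZ]), Finset.prod_eq_zero hmem (by
      rw [if_neg hj]
      split_ifs
      · exact Matrix.one_apply_ne hne
      · exact hZ)]
    simp

/-- Tensor products that agree off qubit `k` are subtracted by subtracting their factors
at `k`. -/
theorem tensorOp_sub_tensorOp {N : ℕ} (k : Fin N) (c : ℂ)
    (f g h : Fin N → Matrix (Fin 2) (Fin 2) ℂ) (hf : ∀ j, j ≠ k → f j = h j)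
    (hg : ∀ j, j ≠ k → g j = h j) (hk : f k - g k = c • h k) :
    tensorOp f - tensorOp g = c • tensorOp h := by
  ext x y
  have hprod : ∀ u : Fin N → Matrix (Fin 2) (Fin 2) ℂ, (∀ j, j ≠ k → u j = h j) →
      ∏ j ∈ Finset.univ.erase k, u j (x j) (y j) = ∏ j ∈ Finset.univ.erase k, h j (x j) (y j) :=
    fun u hu => Finset.prod_congr rfl fun j hj => by rw [hu j (Finset.ne_of_mem_erase hj)]
  simp only [tensorOp, Matrix.sub_apply, Matrix.smul_apply, Matrix.of_apply, smul_eq_mul]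
  rw [← Finset.mul_prod_erase _ (fun j => f j (x j) (y j)) (Finset.mem_univ k),
    ← Finset.mul_prod_erase _ (fun j => g j (x j) (y j)) (Finset.mem_univ k),
    ← Finset.mul_prod_erase _ (fun j => h j (x j) (y j)) (Finset.mem_univ k),
    hprod f hf, hprod g hg, ← sub_mul, ← Matrix.sub_apply, hk, Matrix.smul_apply, smul_eq_mul, mul_assoc]

theorem conjTranspose_rotation {P : Matrix (Fin 2) (Fin 2) ℂ} (hP : Pᴴ = P) (t : ℝ) :
    (rotation P t)ᴴ =
      Complex.cos (t / 2) • 1 + (Complex.I * Complex.sin (t / 2)) • P := by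
  simp [rotation, hP, ← Complex.cos_conj, ← Complex.sin_conj,
    Complex.conj_ofNat]

theorem pX_conjTranspose : pXᴴ = pX := by
  ext i j; fin_cases i <;> fin_cases j <;> simp [pX]

theorem pZ_conjTranspose : pZᴴ = pZ := by
  ext i j; fin_cases i <;> fin_cases j <;> simp [pZ]

theorem cos_eq_half (t : ℂ) :
    Complex.cos t = Complex.cos (t / 2) ^ 2 - Complex.sin (t / 2) ^ 2 := by
  rw [← Complex.cos_two_mul', mul_div_cancel₀ t two_ne_zero]

theorem sin_eq_half (t : ℂ) :
    Complex.sin t = 2 * Complex.sin (t / 2) * Complex.cos (t / 2) := by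
  rw [← Complex.sin_two_mul, mul_div_cancel₀ t two_ne_zero]

theorem rotation_conj_one {P : Matrix (Fin 2) (Fin 2) ℂ} (hP : Pᴴ = P) (hPP : P * P = 1)
    (t : ℝ) : (rotation P t)ᴴ * rotation P t = 1 := by
  rw [conjTranspose_rotation hP, rotation]
  simp only [add_mul, mul_add, smul_mul_assoc, mul_smul_comm, one_mul, mul_one, hPP]
  match_scalars
  · linear_combination Complex.sin_sq_add_cos_sq ((t : ℂ) / 2) -
      Complex.sin ((t : ℂ) / 2) ^ 2 * Complex.I_mul_I
  · ring

theorem rotation_pZ_conj_pZ (t : ℝ) : (rotation pZ t)ᴴ * pZ * rotation pZ t = pZ := by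
  have h : pZ * rotation pZ t = rotation pZ t * pZ := by
    simp [rotation, mul_add, add_mul]
  rw [mul_assoc, h, ← mul_assoc, rotation_conj_one pZ_conjTranspose pZ_mul_self, one_mul]

theorem rotation_pZ_conj_pY (t : ℝ) :
    (rotation pZ t)ᴴ * pY * rotation pZ t = Complex.cos t • pY + Complex.sin t • pX := by
  rw [conjTranspose_rotation pZ_conjTranspose, cos_eq_half t, sin_eq_half t]
  ext i j
  fin_cases i <;> fin_cases j <;> simp [rotation, pX, pY, pZ, Matrix.mul_apply] <;>
    grind [Complex.I_sq]

theorem rotation_pX_conj_pX (t : ℝ) : (rotation pX t)ᴴ * pX * rotation pX t = pX := by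
  have h : pX * rotation pX t = rotation pX t * pX := by
    simp [rotation, mul_add, add_mul]
  rw [mul_assoc, h, ← mul_assoc, rotation_conj_one pX_conjTranspose pX_mul_self, one_mul]

theorem rotation_pX_conj_pY (t : ℝ) :
    (rotation pX t)ᴴ * pY * rotation pX t = Complex.cos t • pY - Complex.sin t • pZ := by
  rw [conjTranspose_rotation pX_conjTranspose, cos_eq_half t, sin_eq_half t]
  ext i j
  fin_cases i <;> fin_cases j <;> simp [rotation, pX, pY, pZ, Matrix.mul_apply] <;>
    grind [Complex.I_sq]

theorem rotation_pX_conj_pZ (t : ℝ) :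
    (rotation pX t)ᴴ * pZ * rotation pX t = Complex.cos t • pZ + Complex.sin t • pY := by
  rw [conjTranspose_rotation pX_conjTranspose, cos_eq_half t, sin_eq_half t]
  ext i j
  fin_cases i <;> fin_cases j <;> simp [rotation, pX, pY, pZ, Matrix.mul_apply] <;>
    grind [Complex.I_sq]

theorem commutator_pX (a b c d : ℂ) :
    pX * (a • (b • pY - c • pZ) + d • pX) - (a • (b • pY - c • pZ) + d • pX) * pX =
      (2 * Complex.I * a) • (b • pZ + c • pY) := by
  ext i j
  fin_cases i <;> fin_cases j <;> simp [pX, pY, pZ] <;>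
    grind [Complex.I_sq]

end Qubits

open Matrix Qubits NormedSpace

/-- For the HEA block
V = CZ_E · ∏_j exp(-i·φ_j·Z_j/2) · ∏_j exp(-i·ϑ·X_j/2) and the global observable
O = Y₁ · ∏_{j=2}^N Z_j, the commutator satisfies
[X₁, V† · O · V] = 2·i·cos(φ₁)·(cos(ϑ)·Z₁ + sin(ϑ)·Y₁) ·
∏_{j ∈ S} (cos(ϑ)·Z_j + sin(ϑ)·Y_j), where S = {2,…,N} \ N(1). -/
theorem stmt_16 {N : ℕ} (hN : 0 < N) (G : SimpleGraph (Fin N)) [DecidableRel G.Adj]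
    (ϑ : ℝ) (φ : Fin N → ℝ)
    (V O : QOp N)
    (hV : V = czLayer G *
      prodOver Finset.univ (fun j => exp ((-Complex.I * (φ j : ℂ) / 2) • onQubit pZ j)) *
      prodOver Finset.univ (fun j => exp ((-Complex.I * (ϑ : ℂ) / 2) • onQubit pX j)))
    (hO : O = onQubit pY ⟨0, hN⟩ *
      prodOver (Finset.univ.erase ⟨0, hN⟩) (fun j => onQubit pZ j)) :
    onQubit pX ⟨0, hN⟩ * (Vᴴ * O * V) - (Vᴴ * O * V) * onQubit pX ⟨0, hN⟩ =
      ((2 * Complex.I * (Real.cos (φ ⟨0, hN⟩) : ℂ)) •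
        ((Real.cos ϑ : ℂ) • onQubit pZ ⟨0, hN⟩ + (Real.sin ϑ : ℂ) • onQubit pY ⟨0, hN⟩)) *
      prodOver (Finset.univ.erase ⟨0, hN⟩ \ G.neighborFinset ⟨0, hN⟩)
        (fun j => (Real.cos ϑ : ℂ) • onQubit pZ j + (Real.sin ϑ : ℂ) • onQubit pY j) := by
  set k : Fin N := ⟨0, hN⟩
  have hW : Vᴴ * O * V = tensorOp fun j => (rotation pX ϑ)ᴴ * ((rotation pZ (φ j))ᴴ *
      (if j = k then pY else if G.Adj k j then 1 else pZ) * rotation pZ (φ j)) *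
      rotation pX ϑ := by
    have hO' : O = tensorOp fun j => if j = k then pY else pZ := by
      rw [hO, prodOver_onQubit, onQubit_eq_tensorOp, tensorOp_mul]
      congr 1
      ext1 j
      by_cases hj : j = k <;> simp [hj]
    simp only [exp_smul_onQubit pZ_mul_self, exp_smul_onQubit pX_mul_self,
      prodOver_onQubit _ fun j => rotation pZ (φ j), prodOver_onQubit _ fun _ => rotation pX ϑ,
      Finset.mem_univ, if_true] at hV
    rw [hV, hO', Matrix.conjTranspose_mul, Matrix.conjTranspose_mul, czLayer_conjTranspose,
      tensorOp_conjTranspose, tensorOp_conjTranspose]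
    simp only [← tensorOp_mul, ← czLayer_conj, mul_assoc]
  simp only [smul_onQubit_add_smul_onQubit]
  rw [prodOver_onQubit _ fun _ => (Real.cos ϑ : ℂ) • pZ + (Real.sin ϑ : ℂ) • pY, hW,
    onQubit_eq_tensorOp, onQubit_eq_tensorOp, smul_mul_assoc, tensorOp_mul, tensorOp_mul,
    tensorOp_mul]
  have hoff : ∀ j, j ≠ k → (rotation pX ϑ)ᴴ * ((rotation pZ (φ j))ᴴ *
      (if j = k then pY else if G.Adj k j then 1 else pZ) * rotation pZ (φ j)) * rotation pX ϑ =
      if j ∈ Finset.univ.erase k \ G.neighborFinset k then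
        (Real.cos ϑ : ℂ) • pZ + (Real.sin ϑ : ℂ) • pY else 1 := by
    intro j hj
    by_cases hadj : G.Adj k j
    · simp [hj, hadj, rotation_conj_one pZ_conjTranspose pZ_mul_self,
        rotation_conj_one pX_conjTranspose pX_mul_self]
    · simp [hj, hadj, rotation_pZ_conj_pZ, rotation_pX_conj_pZ]
  refine tensorOp_sub_tensorOp k _ _ _ _ (fun j hj => ?_) (fun j hj => ?_) ?_
  · simpa only [if_neg hj, one_mul] using hoff j hj
  · simpa only [if_neg hj, one_mul, mul_one] using hoff j hj
  · have hY : (rotation pX ϑ)ᴴ * ((rotation pZ (φ k))ᴴ * pY * rotation pZ (φ k)) *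
        rotation pX ϑ = Complex.cos (φ k) • (Complex.cos ϑ • pY - Complex.sin ϑ • pZ) +
          Complex.sin (φ k) • pX := by
      rw [rotation_pZ_conj_pY, mul_add, add_mul, mul_smul_comm, smul_mul_assoc, mul_smul_comm,
        smul_mul_assoc, rotation_pX_conj_pY, rotation_pX_conj_pX]
    simp only [if_true, hY, commutator_pX]
    simp
end
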